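/- For all x, t ∈ ℂ: (xt;q)_∞ · (−t;q)_∞ = Σ_{n=0}^∞ q^{n(n−1)/2} t^n S_n(x q^{−n}; q), the series converging absolutely. -/

import Mathlib

open Complex

/-- The finite q-shifted factorial `(a;q)_n`. -/
noncomputable def qPoch (q a : ℂ) (n : ℕ) : ℂ := ∏ j ∈ Finset.range n, (1 - a * q ^ j)

/-- The infinite q-shifted factorial `(a;q)_∞`. -/
noncomputable def qPochInf (q a : ℂ) : ℂ := ∏' j : ℕ, (1 - a * q ^ j)

/-- The Stieltjes–Wigert polynomial `S_n(x;q)`. -/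
noncomputable def SW (q : ℝ) (n : ℕ) (x : ℂ) : ℂ :=
  (qPoch (q : ℂ) (q : ℂ) n)⁻¹ *
    ∑ k ∈ Finset.range (n + 1),
      (qPoch (q : ℂ) (q : ℂ) n / (qPoch (q : ℂ) (q : ℂ) k * qPoch (q : ℂ) (q : ℂ) (n - k))) *
        (q : ℂ) ^ (k ^ 2) * (-x) ^ k

/-- The `k`-th term of Euler's expansion of `(z;q)_∞`. -/
noncomputable def eulerTerm (q z : ℂ) (k : ℕ) : ℂ :=
  q ^ (k * (k - 1) / 2) * (-z) ^ k / qPoch q q k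

theorem one_sub_pow_succ_ne_zero {q : ℂ} (hq : ‖q‖ < 1) (k : ℕ) : 1 - q ^ (k + 1) ≠ 0 := by
  intro h
  have h1 : ‖q‖ ^ (k + 1) = 1 := by
    rw [← norm_pow, ← sub_eq_zero.mp h, norm_one]
  exact (pow_lt_one₀ (norm_nonneg q) hq k.succ_ne_zero).ne h1

theorem qPoch_self_ne_zero {q : ℂ} (hq : ‖q‖ < 1) (n : ℕ) : qPoch q q n ≠ 0 := by
  refine Finset.prod_ne_zero_iff.mpr fun j _ => ?_
  rw [← pow_succ']
  exact one_sub_pow_succ_ne_zero hq j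

theorem triangle_succ (k : ℕ) : (k + 1) * (k + 1 - 1) / 2 = k * (k - 1) / 2 + k := by
  rw [← Nat.choose_two_right, ← Nat.choose_two_right, Nat.choose_succ_succ' k 1,
    Nat.choose_one_right, add_comm]

theorem triangle_add (m k : ℕ) :
    (m + k) * (m + k - 1) / 2 = m * (m - 1) / 2 + k * (k - 1) / 2 + m * k := by
  induction k with
  | zero => simp
  | succ k ih => rw [← add_assoc, triangle_succ, ih, triangle_succ]; ring

theorem eulerTerm_zero (q z : ℂ) : eulerTerm q z 0 = 1 := by
  simp [eulerTerm, qPoch]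

theorem eulerTerm_succ (q z : ℂ) (k : ℕ) :
    eulerTerm q z (k + 1) = q ^ k * (-z) / (1 - q ^ (k + 1)) * eulerTerm q z k := by
  rw [eulerTerm, eulerTerm, triangle_succ, qPoch, Finset.prod_range_succ, ← qPoch, ← pow_succ',
    pow_add, pow_succ (-z), div_mul_div_comm]
  congr 1 <;> ring

theorem eulerTerm_pow_mul (q z c : ℂ) (k : ℕ) :
    eulerTerm q (c * z) k = c ^ k * eulerTerm q z k := by
  rw [eulerTerm, eulerTerm, neg_mul_eq_mul_neg, mul_pow]
  ring

theorem summable_norm_eulerTerm {q : ℂ} (hq : ‖q‖ < 1) (z : ℂ) :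
    Summable fun k => ‖eulerTerm q z k‖ := by
  have hp : Filter.Tendsto (fun k : ℕ => q ^ k) Filter.atTop (nhds 0) :=
    tendsto_pow_atTop_nhds_zero_of_norm_lt_one hq
  have hlim : Filter.Tendsto (fun k : ℕ => ‖q ^ k * (-z) / (1 - q ^ (k + 1))‖)
      Filter.atTop (nhds 0) := by
    have h := ((hp.mul_const (-z)).div
      (tendsto_const_nhds.sub (hp.comp (Filter.tendsto_add_atTop_nat 1)))
      (by simp : (1 : ℂ) - 0 ≠ 0)).norm
    simpa using h
  refine summable_of_ratio_norm_eventually_le (r := 1 / 2) (by norm_num) ?_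
  filter_upwards [hlim.eventually (ge_mem_nhds (by norm_num : (0 : ℝ) < 1 / 2))] with k hk
  rw [norm_norm, norm_norm, eulerTerm_succ, norm_mul]
  exact mul_le_mul_of_nonneg_right hk (norm_nonneg _)

theorem tsum_eulerTerm_eq_mul {q : ℂ} (hq : ‖q‖ < 1) (z : ℂ) :
    ∑' k, eulerTerm q z k = (1 - z) * ∑' k, eulerTerm q (q * z) k := by
  have hz := (summable_norm_eulerTerm hq z).of_norm
  have hqz := (summable_norm_eulerTerm hq (q * z)).of_norm
  have h : ∑' k, (eulerTerm q z k - eulerTerm q (q * z) k)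
      = -z * ∑' k, eulerTerm q (q * z) k := by
    rw [(hz.sub hqz).tsum_eq_zero_add, eulerTerm_zero, eulerTerm_zero, sub_self, zero_add,
      ← tsum_mul_left]
    refine tsum_congr fun k => ?_
    have hk := one_sub_pow_succ_ne_zero hq k
    rw [eulerTerm_pow_mul, eulerTerm_pow_mul, eulerTerm_succ]
    field_simp
    ring
  rw [hz.tsum_sub hqz] at h
  linear_combination h

theorem tsum_eulerTerm_eq_qPoch_mul {q : ℂ} (hq : ‖q‖ < 1) (z : ℂ) (n : ℕ) :
    ∑' k, eulerTerm q z k = qPoch q z n * ∑' k, eulerTerm q (q ^ n * z) k := by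
  induction n with
  | zero => simp [qPoch]
  | succ n ih =>
    rw [ih, tsum_eulerTerm_eq_mul hq (q ^ n * z), qPoch, qPoch, Finset.prod_range_succ,
      ← mul_assoc q, ← pow_succ']
    ring

theorem tendsto_qPoch {q : ℂ} (hq : ‖q‖ < 1) (z : ℂ) :
    Filter.Tendsto (qPoch q z) Filter.atTop (nhds (qPochInf q z)) := by
  have hs : Summable fun j : ℕ => ‖-(z * q ^ j)‖ := by
    simp only [norm_neg, norm_mul, norm_pow]
    exact (summable_geometric_of_lt_one (norm_nonneg q) hq).mul_left _
  have h := (multipliable_one_add_of_summable hs).hasProd.tendsto_prod_nat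
  simp only [← sub_eq_add_neg] at h
  exact h

/-- Euler's expansion of `(z;q)_∞`. -/
theorem qPochInf_eq_tsum_eulerTerm {q : ℂ} (hq : ‖q‖ < 1) (z : ℂ) :
    qPochInf q z = ∑' k, eulerTerm q z k := by
  have hlim : Filter.Tendsto (fun n : ℕ => ∑' k, eulerTerm q (q ^ n * z) k) Filter.atTop
      (nhds (∑' k, (0 : ℂ) ^ k * eulerTerm q z k)) := by
    refine tendsto_tsum_of_dominated_convergence (summable_norm_eulerTerm hq z)
      (fun k => ?_) (Filter.Eventually.of_forall fun n k => ?_)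
    · simp only [eulerTerm_pow_mul]
      exact ((tendsto_pow_atTop_nhds_zero_of_norm_lt_one hq).pow k).mul_const _
    · rw [eulerTerm_pow_mul, norm_mul, norm_pow, norm_pow]
      exact mul_le_of_le_one_left (norm_nonneg _)
        (pow_le_one₀ (by positivity) (pow_le_one₀ (norm_nonneg q) hq.le))
  have hone : ∑' k, (0 : ℂ) ^ k * eulerTerm q z k = 1 := by
    rw [tsum_eq_single 0 fun k hk => by simp [hk]]
    simp [eulerTerm_zero]
  rw [hone] at hlim
  have h := (tendsto_qPoch hq z).mul hlim
  simp only [← tsum_eulerTerm_eq_qPoch_mul hq z, mul_one] at h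
  exact tendsto_nhds_unique h tendsto_const_nhds

theorem stieltjesWigert_term_eq_sum {q : ℝ} (hq0 : q ≠ 0) (hq : ‖(q : ℂ)‖ < 1) (x t : ℂ) (n : ℕ) :
    (q : ℂ) ^ (n * (n - 1) / 2) * t ^ n * SW q n (x * (q : ℂ) ^ (-(n : ℤ)))
      = ∑ k ∈ Finset.range (n + 1), eulerTerm q (x * t) k * eulerTerm q (-t) (n - k) := by
  have hqc : (q : ℂ) ≠ 0 := by exact_mod_cast hq0
  rw [SW, Finset.mul_sum, Finset.mul_sum]
  refine Finset.sum_congr rfl fun k hk => ?_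
  obtain ⟨m, rfl⟩ := Nat.exists_eq_add_of_le' (Finset.mem_range_succ_iff.mp hk)
  have h1 := qPoch_self_ne_zero hq (m + k)
  have h2 := qPoch_self_ne_zero hq m
  have h3 := qPoch_self_ne_zero hq k
  rw [Nat.add_sub_cancel, triangle_add, eulerTerm, eulerTerm, neg_neg, zpow_neg, zpow_natCast,
    neg_mul_eq_neg_mul, neg_mul_eq_neg_mul, mul_pow, mul_pow, inv_pow]
  field_simp
  ring

/-- `(xt;q)_∞ (−t;q)_∞ = Σ_{n≥0} q^{n(n−1)/2} t^n S_n(xq^{−n};q)`,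
the series converging absolutely. -/
theorem stieltjes_wigert_generating_function (q : ℝ) (hq0 : 0 < q) (hq1 : q < 1) (x t : ℂ) :
    Summable (fun n : ℕ =>
      (q : ℂ) ^ (n * (n - 1) / 2) * t ^ n * SW q n (x * (q : ℂ) ^ (-(n : ℤ)))) ∧
    qPochInf (q : ℂ) (x * t) * qPochInf (q : ℂ) (-t)
      = ∑' n : ℕ, (q : ℂ) ^ (n * (n - 1) / 2) * t ^ n * SW q n (x * (q : ℂ) ^ (-(n : ℤ))) := by
  have hq : ‖(q : ℂ)‖ < 1 := by
    rwa [Complex.norm_real, Real.norm_of_nonneg hq0.le]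
  have hx := summable_norm_eulerTerm hq (x * t)
  have ht := summable_norm_eulerTerm hq (-t)
  simp only [stieltjesWigert_term_eq_sum hq0.ne' hq]
  refine ⟨(summable_norm_sum_mul_range_of_summable_norm hx ht).of_norm, ?_⟩
  rw [qPochInf_eq_tsum_eulerTerm hq, qPochInf_eq_tsum_eulerTerm hq,
    tsum_mul_tsum_eq_tsum_sum_range_of_summable_norm hx ht]
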